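/- arXiv:2009.08670 — 5 statements merged into one kernel-verified Lean document; each statement's English description precedes it below -/
import Mathlib

section
/- Let H be a real Hilbert space, Σ ⊆ H, A : H → ℝ^m a continuous linear map, and γ ∈ (0,1) such that (1−γ)‖u−v‖² ≤ ‖A(u−v)‖₂² for all u, v ∈ Σ. Let x0 ∈ Σ, e ∈ ℝ^m, y = Ax0 + e, and let C ≥ 0 and (x_n)_{n≥1} be a sequence in Σ with ‖Ax_n − y‖₂² ≤ ‖e‖₂² + C/n for all n ≥ 1. Then for all n ≥ 1: ‖x_n − x0‖² ≤ 4‖e‖₂²/(1−γ) + 2C/((1−γ)·n). -/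
/-- Recovery guarantee along a sequence with objective values converging at rate `O(1/n)`:
if `A` has a lower RIP with constant `γ` on differences of elements of `Σ`, `y = A x0 + e`
with `x0 ∈ Σ`, and `‖A xₙ - y‖² ≤ ‖e‖² + C/n`, then
`‖xₙ - x0‖² ≤ 4‖e‖²/(1-γ) + 2C/((1-γ) n)`. -/
theorem stmt_6 {H : Type*} [NormedAddCommGroup H] [InnerProductSpace ℝ H]
    {m : ℕ} (Sig : Set H) (A : H →L[ℝ] EuclideanSpace ℝ (Fin m))
    (γ : ℝ) (hγ : γ ∈ Set.Ioo (0 : ℝ) 1)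
    (hRIP : ∀ u ∈ Sig, ∀ v ∈ Sig, (1 - γ) * ‖u - v‖ ^ 2 ≤ ‖A (u - v)‖ ^ 2)
    (x0 : H) (hx0 : x0 ∈ Sig) (e : EuclideanSpace ℝ (Fin m))
    (y : EuclideanSpace ℝ (Fin m)) (hy : y = A x0 + e)
    (C : ℝ) (hC : 0 ≤ C) (x : ℕ → H) (hxS : ∀ n : ℕ, 1 ≤ n → x n ∈ Sig)
    (hx : ∀ n : ℕ, 1 ≤ n → ‖A (x n) - y‖ ^ 2 ≤ ‖e‖ ^ 2 + C / n) :
    ∀ n : ℕ, 1 ≤ n →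
      ‖x n - x0‖ ^ 2 ≤ 4 * ‖e‖ ^ 2 / (1 - γ) + 2 * C / ((1 - γ) * n) := by
  intro n hn
  have hpos : 0 < 1 - γ := sub_pos.mpr hγ.2
  have hn0 : (0 : ℝ) < n := by exact_mod_cast hn
  have htri : ‖A (x n - x0)‖ ≤ ‖A (x n) - y‖ + ‖e‖ := by
    have heq : A (x n - x0) = (A (x n) - y) + e := by
      rw [hy, map_sub]
      abel
    rw [heq]
    exact norm_add_le _ _
  have hsq : ‖A (x n - x0)‖ ^ 2 ≤ 2 * (‖A (x n) - y‖ ^ 2 + ‖e‖ ^ 2) :=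
    (pow_le_pow_left₀ (norm_nonneg _) htri 2).trans add_sq_le
  have hbound : (1 - γ) * ‖x n - x0‖ ^ 2 ≤ 4 * ‖e‖ ^ 2 + 2 * (C / n) := by
    linarith [hRIP (x n) (hxS n hn) x0 hx0, hx n hn]
  calc ‖x n - x0‖ ^ 2 ≤ (4 * ‖e‖ ^ 2 + 2 * (C / n)) / (1 - γ) := by
        rwa [le_div_iff₀' hpos]
    _ = 4 * ‖e‖ ^ 2 / (1 - γ) + 2 * C / ((1 - γ) * n) := by
        field_simp
end

section
/- Let p ≥ 1, let Γ be a real symmetric positive-definite p×p matrix, and let λ > 0. For w, t0 ∈ ℝ^p define I(w, t0) := ∫_{ℝ^p} ∫_{ℝ^p} exp(−½λ²(t−s)ᵀΓ⁻¹(t−s)) · (wᵀΓ⁻¹(s−t0)) · (wᵀΓ⁻¹(t−t0)) · exp(−½(s−t0)ᵀΓ⁻¹(s−t0)) · exp(−½(t−t0)ᵀΓ⁻¹(t−t0)) ds dt. Then there exists a constant d > 0, depending only on p, λ and Γ, such that I(w, t0) ≥ d · ‖w‖₂² for all w, t0 ∈ ℝ^p. -/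
open Matrix MeasureTheory

/-- A continuous function, positive away from zero and homogeneous of degree two, dominates a
positive multiple of the squared norm. -/
lemma exists_pos_mul_norm_sq_le {E : Type*} [NormedAddCommGroup E] [NormedSpace ℝ E]
    [ProperSpace E] {f : E → ℝ} (hf : Continuous f) (hsmul : ∀ (c : ℝ) x, f (c • x) = c ^ 2 * f x)
    (hpos : ∀ x, x ≠ 0 → 0 < f x) : ∃ m, 0 < m ∧ ∀ x, m * ‖x‖ ^ 2 ≤ f x := by
  obtain ⟨m, hm, hle⟩ := (isCompact_sphere (0 : E) 1).exists_forall_le' hf.continuousOn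
    (a := 0) (fun x hx => hpos x (by rintro rfl; simp at hx))
  refine ⟨m, hm, fun x => ?_⟩
  rcases eq_or_ne x 0 with rfl | hx
  · have h : f 0 = 0 := by simpa using hsmul 0 0
    simp [h]
  · have hx' : 0 < ‖x‖ := norm_pos_iff.2 hx
    have h := hle (‖x‖⁻¹ • x) (by simp [norm_smul, hx'.ne'])
    rw [hsmul, inv_pow, ← div_eq_inv_mul, le_div_iff₀ (by positivity)] at h
    exact h

section QuadraticGaussian

variable {ι : Type*} [Fintype ι] {Q : Matrix ι ι ℝ}

lemma continuous_dotProduct_mulVec_self (Q : Matrix ι ι ℝ) :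
    Continuous fun t : ι → ℝ => t ⬝ᵥ (Q *ᵥ t) := by
  fun_prop

lemma Matrix.PosDef.exists_pos_mul_norm_sq_le (hQ : Q.PosDef) :
    ∃ m, 0 < m ∧ ∀ t : ι → ℝ, m * ‖t‖ ^ 2 ≤ t ⬝ᵥ (Q *ᵥ t) := by
  refine _root_.exists_pos_mul_norm_sq_le (continuous_dotProduct_mulVec_self Q) (fun c x => ?_)
    fun x hx => by simpa using hQ.dotProduct_mulVec_pos hx
  simp only [mulVec_smul, smul_dotProduct, dotProduct_smul, smul_eq_mul]
  ring

lemma sum_sq_le_card_mul_norm_sq (t : ι → ℝ) :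
    ∑ i, t i ^ 2 ≤ Fintype.card ι * ‖t‖ ^ 2 := by
  have h : ∀ i ∈ Finset.univ, t i ^ 2 ≤ ‖t‖ ^ 2 := fun i _ =>
    sq_le_sq.2 (by simpa using norm_le_pi_norm t i)
  simpa using Finset.sum_le_sum h

lemma integrable_exp_neg_mul_norm_sq {b : ℝ} (hb : 0 < b) :
    Integrable fun t : ι → ℝ => Real.exp (-b * ‖t‖ ^ 2) := by
  have hc : 0 < b / (Fintype.card ι + 1 : ℝ) := by positivity
  have h : Integrable fun t : ι → ℝ =>
      ∏ i, Real.exp (-(b / (Fintype.card ι + 1 : ℝ)) * t i ^ 2) :=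
    Integrable.fintype_prod fun _ => integrable_exp_neg_mul_sq hc
  refine h.mono' (by fun_prop) (.of_forall fun t => ?_)
  rw [Real.norm_of_nonneg (Real.exp_nonneg _), ← Real.exp_sum, ← Finset.mul_sum]
  refine Real.exp_le_exp.2 ?_
  have h1 := sum_sq_le_card_mul_norm_sq t
  rw [neg_mul, neg_mul, neg_le_neg_iff, div_mul_eq_mul_div, div_le_iff₀ (by positivity)]
  nlinarith [sq_nonneg ‖t‖, mul_nonneg hb.le (sq_nonneg ‖t‖)]

/-- Functions of at most quadratic growth are integrable against a Gaussian density. -/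
lemma Matrix.PosDef.integrable_mul_exp_neg (hQ : Q.PosDef) {c : ℝ} (hc : 0 < c)
    {f : (ι → ℝ) → ℝ} (hf : Continuous f) {C : ℝ} (hfC : ∀ t, |f t| ≤ C * (1 + ‖t‖ ^ 2)) :
    Integrable fun t : ι → ℝ => f t * Real.exp (-c * (t ⬝ᵥ (Q *ᵥ t))) := by
  obtain ⟨m, hm, hle⟩ := hQ.exists_pos_mul_norm_sq_le
  have hb : 0 < c * m / 2 := by positivity
  have hC : 0 ≤ C := by simpa using (abs_nonneg _).trans (hfC 0)
  have hq := continuous_dotProduct_mulVec_self Q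
  refine ((integrable_exp_neg_mul_norm_sq hb).const_mul (C * (1 + (c * m / 2)⁻¹))).mono'
    (by fun_prop) (.of_forall fun t => ?_)
  rw [Real.norm_eq_abs, abs_mul, Real.abs_exp]
  set b := c * m / 2
  have h1 : 1 + ‖t‖ ^ 2 ≤ (1 + b⁻¹) * Real.exp (b * ‖t‖ ^ 2) := by
    have h2 := Real.add_one_le_exp (b * ‖t‖ ^ 2)
    have h3 : 1 ≤ Real.exp (b * ‖t‖ ^ 2) := Real.one_le_exp (by positivity)
    have h4 : ‖t‖ ^ 2 ≤ b⁻¹ * Real.exp (b * ‖t‖ ^ 2) := by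
      rw [← div_eq_inv_mul, le_div_iff₀ hb]
      linarith
    linarith
  calc |f t| * Real.exp (-c * (t ⬝ᵥ (Q *ᵥ t)))
      ≤ (C * ((1 + b⁻¹) * Real.exp (b * ‖t‖ ^ 2))) * Real.exp (-(2 * b) * ‖t‖ ^ 2) := by
        refine mul_le_mul ((hfC t).trans (mul_le_mul_of_nonneg_left h1 hC))
          (Real.exp_le_exp.2 ?_) (Real.exp_nonneg _) (by positivity)
        have := mul_le_mul_of_nonneg_left (hle t) hc.le
        simp only [b]
        linarith
    _ = C * (1 + b⁻¹) * Real.exp (-b * ‖t‖ ^ 2) := by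
        rw [← mul_assoc, mul_assoc, ← Real.exp_add]
        congr 2
        ring

lemma abs_dotProduct_le (v t : ι → ℝ) : |v ⬝ᵥ t| ≤ (∑ i, |v i|) * ‖t‖ := by
  rw [dotProduct, Finset.sum_mul]
  refine (Finset.abs_sum_le_sum_abs _ _).trans (Finset.sum_le_sum fun i _ => ?_)
  rw [abs_mul]
  exact mul_le_mul_of_nonneg_left (norm_le_pi_norm t i) (abs_nonneg _)

lemma Matrix.PosDef.integrable_exp_neg (hQ : Q.PosDef) {c : ℝ} (hc : 0 < c) :
    Integrable fun t : ι → ℝ => Real.exp (-c * (t ⬝ᵥ (Q *ᵥ t))) := by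
  simpa using hQ.integrable_mul_exp_neg hc (f := fun _ => 1) continuous_const (C := 1)
    (fun t => by simp)

lemma Matrix.PosDef.integrable_dotProduct_mul_exp_neg (hQ : Q.PosDef) {c : ℝ} (hc : 0 < c)
    (v : ι → ℝ) :
    Integrable fun t : ι → ℝ => (v ⬝ᵥ t) * Real.exp (-c * (t ⬝ᵥ (Q *ᵥ t))) := by
  refine hQ.integrable_mul_exp_neg hc (by fun_prop) (C := ∑ i, |v i|) fun t =>
    (abs_dotProduct_le v t).trans (mul_le_mul_of_nonneg_left ?_ (by positivity))
  nlinarith [sq_nonneg (‖t‖ - 1)]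

lemma Matrix.PosDef.integrable_dotProduct_sq_mul_exp_neg (hQ : Q.PosDef) {c : ℝ} (hc : 0 < c)
    (v : ι → ℝ) :
    Integrable fun t : ι → ℝ => (v ⬝ᵥ t) ^ 2 * Real.exp (-c * (t ⬝ᵥ (Q *ᵥ t))) := by
  refine hQ.integrable_mul_exp_neg hc (by fun_prop) (C := (∑ i, |v i|) ^ 2) fun t => ?_
  rw [abs_pow]
  refine (pow_le_pow_left₀ (abs_nonneg _) (abs_dotProduct_le v t) 2).trans ?_
  rw [mul_pow]
  exact mul_le_mul_of_nonneg_left (by linarith) (by positivity)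

/-- The second moments of a centred Gaussian density form a positive definite quadratic form. -/
lemma Matrix.PosDef.exists_mul_norm_sq_le_integral (hQ : Q.PosDef) {c : ℝ} (hc : 0 < c) :
    ∃ m, 0 < m ∧ ∀ v : ι → ℝ,
      m * ‖v‖ ^ 2 ≤ ∫ t : ι → ℝ, (v ⬝ᵥ t) ^ 2 * Real.exp (-c * (t ⬝ᵥ (Q *ᵥ t))) := by
  suffices ∃ m, 0 < m ∧ ∀ v : ι → ℝ, m * ‖v‖ ^ 2 ≤ ∫ t in Metric.closedBall (0 : ι → ℝ) 1,
      (v ⬝ᵥ t) ^ 2 * Real.exp (-c * (t ⬝ᵥ (Q *ᵥ t))) by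
    obtain ⟨m, hm, hle⟩ := this
    exact ⟨m, hm, fun v => (hle v).trans
      (setIntegral_le_integral (hQ.integrable_dotProduct_sq_mul_exp_neg hc v)
        (.of_forall fun t => by positivity))⟩
  refine _root_.exists_pos_mul_norm_sq_le ?_ ?_ ?_
  · refine continuous_parametric_integral_of_continuous ?_ (isCompact_closedBall _ _)
    simp only [Function.uncurry_def]
    fun_prop
  · intro a v
    rw [← integral_const_mul]
    congr 1 with t
    rw [smul_dotProduct, smul_eq_mul]
    ring
  · intro v hv
    rw [setIntegral_pos_iff_support_of_nonneg_ae (.of_forall fun t => by positivity)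
      (hQ.integrable_dotProduct_sq_mul_exp_neg hc v).integrableOn]
    have hopen : IsOpen ({t : ι → ℝ | v ⬝ᵥ t ≠ 0} ∩ Metric.ball 0 1) :=
      (isOpen_ne_fun (by fun_prop) continuous_const).inter Metric.isOpen_ball
    refine (hopen.measure_pos volume ?_).trans_le (measure_mono ?_)
    · have hv' : 0 < ‖v‖ := norm_pos_iff.2 hv
      refine ⟨(2 * ‖v‖)⁻¹ • v, ?_, ?_⟩
      · simp [dotProduct_smul, hv]
      · simp only [mem_ball_zero_iff, norm_smul, norm_inv, norm_mul, norm_norm, Real.norm_ofNat]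
        field_simp
        norm_num
    · rintro t ⟨ht, hb⟩
      refine ⟨?_, Metric.ball_subset_closedBall hb⟩
      simpa using ht

lemma integral_dotProduct_mul_exp_neg_eq_zero (Q : Matrix ι ι ℝ) (c : ℝ) (v : ι → ℝ) :
    ∫ t : ι → ℝ, (v ⬝ᵥ t) * Real.exp (-c * (t ⬝ᵥ (Q *ᵥ t))) = 0 := by
  have h := integral_neg_eq_self
    (fun t : ι → ℝ => (v ⬝ᵥ t) * Real.exp (-c * (t ⬝ᵥ (Q *ᵥ t)))) volume
  simp only [mulVec_neg, dotProduct_neg, neg_dotProduct, neg_neg, neg_mul, integral_neg] at h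
  simp only [neg_mul]
  linarith

/-- Integrating a linear form against the product of two Gaussian densities. -/
lemma Matrix.PosDef.integral_gaussian_kernel (hQ : Q.PosDef) {a : ℝ} (ha : 0 < a)
    (v x : ι → ℝ) :
    ∫ s : ι → ℝ, Real.exp (-(a / 2) * ((x - s) ⬝ᵥ (Q *ᵥ (x - s)))) * (v ⬝ᵥ s) *
        Real.exp (-(1 / 2 : ℝ) * (s ⬝ᵥ (Q *ᵥ s))) =
      a / (1 + a) * (v ⬝ᵥ x) * Real.exp (-(a / (1 + a) / 2) * (x ⬝ᵥ (Q *ᵥ x))) *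
        ∫ s : ι → ℝ, Real.exp (-((1 + a) / 2) * (s ⬝ᵥ (Q *ᵥ s))) := by
  have hc : 0 < (1 + a) / 2 := by positivity
  set k := a / (1 + a) with hk
  have hk' : k * (1 + a) = a := by rw [hk]; field_simp
  rw [← integral_add_right_eq_self _ (k • x)]
  have hsymm (s : ι → ℝ) : s ⬝ᵥ (Q *ᵥ x) = x ⬝ᵥ (Q *ᵥ s) := by
    rw [dotProduct_mulVec, dotProduct_comm, ← mulVec_transpose]
    congr 2
    simpa using hQ.isHermitian.eq
  have hpt (s : ι → ℝ) :
      Real.exp (-(a / 2) * ((x - (s + k • x)) ⬝ᵥ (Q *ᵥ (x - (s + k • x))))) *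
          (v ⬝ᵥ (s + k • x)) *
          Real.exp (-(1 / 2 : ℝ) * ((s + k • x) ⬝ᵥ (Q *ᵥ (s + k • x)))) =
        Real.exp (-(k / 2) * (x ⬝ᵥ (Q *ᵥ x))) *
          ((v ⬝ᵥ s) * Real.exp (-((1 + a) / 2) * (s ⬝ᵥ (Q *ᵥ s))) +
            k * (v ⬝ᵥ x) * Real.exp (-((1 + a) / 2) * (s ⬝ᵥ (Q *ᵥ s)))) := by
    have hexp : -(a / 2) * ((x - (s + k • x)) ⬝ᵥ (Q *ᵥ (x - (s + k • x)))) +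
        -(1 / 2 : ℝ) * ((s + k • x) ⬝ᵥ (Q *ᵥ (s + k • x))) =
        -(k / 2) * (x ⬝ᵥ (Q *ᵥ x)) + -((1 + a) / 2) * (s ⬝ᵥ (Q *ᵥ s)) := by
      simp only [mulVec_sub, mulVec_add, mulVec_smul, dotProduct_sub, dotProduct_add,
        dotProduct_smul, sub_dotProduct, add_dotProduct, smul_dotProduct, smul_eq_mul, hsymm]
      linear_combination (-(x ⬝ᵥ (Q *ᵥ s)) - k / 2 * (x ⬝ᵥ (Q *ᵥ x)) +
        1 / 2 * (x ⬝ᵥ (Q *ᵥ x))) * hk'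
    rw [mul_right_comm, ← Real.exp_add, hexp, Real.exp_add, dotProduct_add, dotProduct_smul,
      smul_eq_mul]
    ring
  simp only [hpt]
  rw [integral_const_mul, integral_add (hQ.integrable_dotProduct_mul_exp_neg hc v)
    ((hQ.integrable_exp_neg hc).const_mul _), integral_dotProduct_mul_exp_neg_eq_zero,
    integral_const_mul]
  ring

end QuadraticGaussian

/-- Lemma 6.2 of the paper: the squared kernel norm of the directional derivative (in
its mean) of a Gaussian measure is bounded below by `d_K ‖w‖₂²` with `d_K > 0` depending
only on `p`, `λ` and `Γ`. -/
theorem stmt_10 {p : ℕ} (hp : 1 ≤ p)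
    (Γ : Matrix (Fin p) (Fin p) ℝ) (hΓ : Γ.PosDef) (lam : ℝ) (hlam : 0 < lam)
    (I : (Fin p → ℝ) → (Fin p → ℝ) → ℝ)
    (hI : ∀ w t0, I w t0 = ∫ t : Fin p → ℝ, ∫ s : Fin p → ℝ,
      Real.exp (-(lam ^ 2 / 2) * ((t - s) ⬝ᵥ (Γ⁻¹ *ᵥ (t - s)))) *
        (w ⬝ᵥ (Γ⁻¹ *ᵥ (s - t0))) * (w ⬝ᵥ (Γ⁻¹ *ᵥ (t - t0))) *
        Real.exp (-(1 / 2 : ℝ) * ((s - t0) ⬝ᵥ (Γ⁻¹ *ᵥ (s - t0)))) *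
        Real.exp (-(1 / 2 : ℝ) * ((t - t0) ⬝ᵥ (Γ⁻¹ *ᵥ (t - t0))))) :
    ∃ dK : ℝ, 0 < dK ∧ ∀ w t0 : Fin p → ℝ, dK * (∑ i, w i ^ 2) ≤ I w t0 := by
  have hQ : (Γ⁻¹).PosDef := hΓ.inv
  set Q := Γ⁻¹
  have ha : 0 < lam ^ 2 := by positivity
  set a := lam ^ 2
  have hk : 0 < a / (1 + a) := by positivity
  set Z := ∫ s : Fin p → ℝ, Real.exp (-((1 + a) / 2) * (s ⬝ᵥ (Q *ᵥ s))) with hZdef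
  have hZ : 0 < Z := integral_exp_pos (hQ.integrable_exp_neg (by positivity))
  have hc : 0 < (1 + a / (1 + a)) / 2 := by positivity
  obtain ⟨m, hm, hle⟩ := hQ.exists_mul_norm_sq_le_integral hc
  obtain ⟨m', hm', hle'⟩ := exists_pos_mul_norm_sq_le (E := Fin p → ℝ)
    (f := fun w => ‖w ᵥ* Q‖ ^ 2) (by fun_prop)
    (fun c w => by simp [smul_vecMul, norm_smul, mul_pow])
    (fun w hw => by
      have h : w ᵥ* Q ≠ 0 := fun h0 => by
        have h1 := hQ.dotProduct_mulVec_pos hw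
        simp [dotProduct_mulVec, h0] at h1
      have := norm_pos_iff.2 h
      positivity)
  have hval (w t0 : Fin p → ℝ) : I w t0 = a / (1 + a) * Z *
      ∫ t : Fin p → ℝ, ((w ᵥ* Q) ⬝ᵥ t) ^ 2 *
        Real.exp (-((1 + a / (1 + a)) / 2) * (t ⬝ᵥ (Q *ᵥ t))) := by
    rw [hI, ← integral_add_right_eq_self _ t0, ← integral_const_mul]
    congr 1 with t
    rw [← integral_add_right_eq_self _ t0]
    simp only [add_sub_add_right_eq_sub, add_sub_cancel_right, dotProduct_mulVec w]
    have hpt (s : Fin p → ℝ) :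
        Real.exp (-(a / 2) * ((t - s) ⬝ᵥ (Q *ᵥ (t - s)))) * ((w ᵥ* Q) ⬝ᵥ s) *
          ((w ᵥ* Q) ⬝ᵥ t) * Real.exp (-(1 / 2 : ℝ) * (s ⬝ᵥ (Q *ᵥ s))) *
          Real.exp (-(1 / 2 : ℝ) * (t ⬝ᵥ (Q *ᵥ t))) =
        ((w ᵥ* Q) ⬝ᵥ t) * Real.exp (-(1 / 2 : ℝ) * (t ⬝ᵥ (Q *ᵥ t))) *
          (Real.exp (-(a / 2) * ((t - s) ⬝ᵥ (Q *ᵥ (t - s)))) * ((w ᵥ* Q) ⬝ᵥ s) *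
            Real.exp (-(1 / 2 : ℝ) * (s ⬝ᵥ (Q *ᵥ s)))) := by ring
    simp only [hpt]
    rw [integral_const_mul, hQ.integral_gaussian_kernel ha, ← hZdef]
    have hexp : -((1 + a / (1 + a)) / 2) * (t ⬝ᵥ (Q *ᵥ t)) =
        -(1 / 2 : ℝ) * (t ⬝ᵥ (Q *ᵥ t)) + -(a / (1 + a) / 2) * (t ⬝ᵥ (Q *ᵥ t)) := by ring
    rw [hexp, Real.exp_add]
    ring
  have hp' : (0 : ℝ) < p := by exact_mod_cast hp
  refine ⟨a / (1 + a) * Z * (m * (m' / p)), by positivity, fun w t0 => ?_⟩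
  rw [hval, mul_assoc (a / (1 + a) * Z)]
  refine mul_le_mul_of_nonneg_left (le_trans ?_ (hle (w ᵥ* Q))) (by positivity)
  rw [mul_assoc]
  refine mul_le_mul_of_nonneg_left (le_trans ?_ (hle' w)) hm.le
  rw [div_mul_eq_mul_div, div_le_iff₀ hp', mul_assoc, mul_comm (‖w‖ ^ 2)]
  exact mul_le_mul_of_nonneg_left (by simpa using sum_sq_le_card_mul_norm_sq w) hm'.le
end

section
/- Let p ≥ 1, let Γ be a real symmetric positive-definite p×p matrix, and let λ > 0. For w, t0 ∈ ℝ^p define I(w, t0) := ∫_{ℝ^p} ∫_{ℝ^p} exp(−½λ²(t−s)ᵀΓ⁻¹(t−s)) · (wᵀΓ⁻¹(s−t0)) · (wᵀΓ⁻¹(t−t0)) · exp(−½(s−t0)ᵀΓ⁻¹(s−t0)) · exp(−½(t−t0)ᵀΓ⁻¹(t−t0)) ds dt. Then I(w, t0) ≤ D_K · ‖w‖₂² for all w, t0 ∈ ℝ^p, where D_K := ∫_{ℝ^p} ∫_{ℝ^p} exp(−½λ²(t−s)ᵀΓ⁻¹(t−s)) · ‖Γ⁻¹s‖₂ · ‖Γ⁻¹t‖₂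 · exp(−½sᵀΓ⁻¹s) · exp(−½tᵀΓ⁻¹t) ds dt is a finite constant. -/
open Matrix MeasureTheory

theorem Matrix.PosDef.exists_pos_mul_sum_sq_le {ι : Type*} [Fintype ι] {M : Matrix ι ι ℝ}
    (hM : M.PosDef) : ∃ c > 0, ∀ x : ι → ℝ, c * ∑ i, x i ^ 2 ≤ x ⬝ᵥ (M *ᵥ x) := by
  classical
  let K : Set (ι → ℝ) := {x | ∑ i, x i ^ 2 = 1}
  have hK : IsCompact K := by
    refine Metric.isCompact_of_isClosed_isBounded
      (isClosed_eq (by fun_prop) continuous_const) ?_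
    refine (Metric.isBounded_closedBall (x := (0 : ι → ℝ)) (r := 1)).subset fun x hx => ?_
    rw [mem_closedBall_zero_iff, pi_norm_le_iff_of_nonneg zero_le_one]
    intro i
    have hi : x i ^ 2 ≤ ∑ j, x j ^ 2 :=
      Finset.single_le_sum (f := fun j => x j ^ 2) (fun j _ => sq_nonneg _) (Finset.mem_univ i)
    rw [Set.mem_ofPred_eq.mp hx] at hi
    exact abs_le_one_iff_mul_self_le_one.mpr (by nlinarith)
  have hpos : ∀ x : ι → ℝ, x ≠ 0 → 0 < x ⬝ᵥ (M *ᵥ x) := fun x hx => by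
    simpa using hM.dotProduct_mulVec_pos hx
  obtain ⟨c, hc, h⟩ := hK.exists_forall_le' (a := 0) (f := fun x => x ⬝ᵥ (M *ᵥ x))
    (by fun_prop) fun x hx => hpos x (by rintro rfl; simp [K] at hx)
  refine ⟨c, hc, fun x => ?_⟩
  rcases eq_or_ne x 0 with rfl | hx
  · simp
  set S := ∑ i, x i ^ 2 with hS
  have hS0 : 0 < S := by
    obtain ⟨i, hi⟩ := Function.ne_iff.mp hx
    exact Finset.sum_pos' (fun j _ => sq_nonneg _) ⟨i, Finset.mem_univ i, sq_pos_of_ne_zero hi⟩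
  have hr : (√S)⁻¹ ^ 2 = S⁻¹ := by rw [inv_pow, Real.sq_sqrt hS0.le]
  have key := h ((√S)⁻¹ • x) (by
    simp only [K, Set.mem_ofPred_eq, Pi.smul_apply, smul_eq_mul, mul_pow, hr]
    rw [← Finset.mul_sum, ← hS, inv_mul_cancel₀ hS0.ne'])
  simp only [mulVec_smul, smul_dotProduct, dotProduct_smul, smul_eq_mul, ← mul_assoc] at key
  rwa [← sq, hr, ← div_eq_inv_mul, le_div_iff₀ hS0] at key

theorem Real.mul_exp_neg_mul_sq_le {k : ℝ} (hk : 0 < k) (y : ℝ) :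
    y * Real.exp (-(k * y ^ 2)) ≤ 1 / k + 1 := by
  rw [Real.exp_neg, ← div_eq_mul_inv, div_le_iff₀ (Real.exp_pos _)]
  have h1 : k * y ^ 2 + 1 ≤ Real.exp (k * y ^ 2) := Real.add_one_le_exp _
  have h2 : (1 / k + 1) * (k * y ^ 2 + 1) = y ^ 2 + 1 / k + k * y ^ 2 + 1 := by
    field_simp
    ring
  have h3 : 0 < 1 / k := by positivity
  have h4 : 0 ≤ k * y ^ 2 := by positivity
  nlinarith [mul_le_mul_of_nonneg_left h1 (by positivity : 0 ≤ 1 / k + 1), sq_nonneg (y - 1)]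

theorem integrable_exp_neg_mul_sum_sq {ι : Type*} [Fintype ι] {c : ℝ} (hc : 0 < c) :
    Integrable fun x : ι → ℝ => Real.exp (-c * ∑ i, x i ^ 2) := by
  simp_rw [Finset.mul_sum, Real.exp_sum]
  exact Integrable.fintype_prod (f := fun _ y => Real.exp (-c * y ^ 2))
    fun _ => integrable_exp_neg_mul_sq hc

theorem Matrix.PosDef.integrable_norm_mul_exp {ι : Type*} [Fintype ι] [DecidableEq ι]
    {Γ : Matrix ι ι ℝ} (hΓ : Γ.PosDef) :
    Integrable fun x : ι → ℝ => √(∑ i, (Γ⁻¹ *ᵥ x) i ^ 2) *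
      Real.exp (-(1 / 2 : ℝ) * (x ⬝ᵥ (Γ⁻¹ *ᵥ x))) := by
  obtain ⟨a, ha, hQa⟩ := hΓ.exists_pos_mul_sum_sq_le
  obtain ⟨b, hb, hQb⟩ := hΓ.inv.exists_pos_mul_sum_sq_le
  refine ((integrable_exp_neg_mul_sum_sq (ι := ι) (c := b / 4) (by positivity)).const_mul
    (1 / (a / 4) + 1)).mono' (Continuous.aestronglyMeasurable (by fun_prop))
    (Filter.Eventually.of_forall fun x => ?_)
  rw [Real.norm_of_nonneg (by positivity)]
  have h1 := hQa (Γ⁻¹ *ᵥ x)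
  rw [mulVec_mulVec, mul_nonsing_inv _ ((isUnit_iff_isUnit_det _).mp hΓ.isUnit), one_mulVec,
    dotProduct_comm] at h1
  have h2 := hQb x
  set n := √(∑ i, (Γ⁻¹ *ᵥ x) i ^ 2)
  have hn2 : n ^ 2 = ∑ i, (Γ⁻¹ *ᵥ x) i ^ 2 := Real.sq_sqrt (by positivity)
  calc n * Real.exp (-(1 / 2 : ℝ) * (x ⬝ᵥ (Γ⁻¹ *ᵥ x)))
      ≤ n * Real.exp (-(a / 4 * n ^ 2) + -(b / 4) * ∑ i, x i ^ 2) := by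
        gcongr
        rw [hn2]
        linarith
    _ = n * Real.exp (-(a / 4 * n ^ 2)) * Real.exp (-(b / 4) * ∑ i, x i ^ 2) := by
        rw [Real.exp_add, mul_assoc]
    _ ≤ _ := by
        gcongr
        exact Real.mul_exp_neg_mul_sq_le (by positivity) n

theorem MeasureTheory.integral_mono_of_nonneg_right {α : Type*} [MeasurableSpace α]
    {μ : Measure α} {f g : α → ℝ} (hg : Integrable g μ) (hg0 : 0 ≤ g) (h : f ≤ g) :
    ∫ x, f x ∂μ ≤ ∫ x, g x ∂μ := by
  by_cases hf : Integrable f μ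
  · exact integral_mono hf hg h
  · rw [integral_undef hf]
    exact integral_nonneg hg0

theorem abs_dotProduct_le_sqrt_mul_sqrt {ι : Type*} [Fintype ι] (v w : ι → ℝ) :
    |v ⬝ᵥ w| ≤ √(∑ i, v i ^ 2) * √(∑ i, w i ^ 2) := by
  rw [← Real.sqrt_mul (by positivity)]
  exact Real.abs_le_sqrt (Finset.sum_mul_sq_le_sq_mul_sq _ v w)

/-- First bound of Lemma 6.3 of the paper: the squared kernel norm of the directional
derivative (in its mean) of a Gaussian measure is bounded above by `D_K ‖w‖₂²`, with
`D_K` the explicit finite constant given by a Gaussian double integral. -/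
theorem stmt_11 {p : ℕ} (hp : 1 ≤ p)
    (Γ : Matrix (Fin p) (Fin p) ℝ) (hΓ : Γ.PosDef) (lam : ℝ) (hlam : 0 < lam)
    (I : (Fin p → ℝ) → (Fin p → ℝ) → ℝ)
    (hI : ∀ w t0, I w t0 = ∫ t : Fin p → ℝ, ∫ s : Fin p → ℝ,
      Real.exp (-(lam ^ 2 / 2) * ((t - s) ⬝ᵥ (Γ⁻¹ *ᵥ (t - s)))) *
        (w ⬝ᵥ (Γ⁻¹ *ᵥ (s - t0))) * (w ⬝ᵥ (Γ⁻¹ *ᵥ (t - t0))) *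
        Real.exp (-(1 / 2 : ℝ) * ((s - t0) ⬝ᵥ (Γ⁻¹ *ᵥ (s - t0)))) *
        Real.exp (-(1 / 2 : ℝ) * ((t - t0) ⬝ᵥ (Γ⁻¹ *ᵥ (t - t0)))))
    (DK : ℝ)
    (hDK : DK = ∫ t : Fin p → ℝ, ∫ s : Fin p → ℝ,
      Real.exp (-(lam ^ 2 / 2) * ((t - s) ⬝ᵥ (Γ⁻¹ *ᵥ (t - s)))) *
        Real.sqrt (∑ i, (Γ⁻¹ *ᵥ s) i ^ 2) * Real.sqrt (∑ i, (Γ⁻¹ *ᵥ t) i ^ 2) *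
        Real.exp (-(1 / 2 : ℝ) * (s ⬝ᵥ (Γ⁻¹ *ᵥ s))) *
        Real.exp (-(1 / 2 : ℝ) * (t ⬝ᵥ (Γ⁻¹ *ᵥ t)))) :
    ∀ w t0 : Fin p → ℝ, I w t0 ≤ DK * (∑ i, w i ^ 2) := by
  intro w t0
  let Q : (Fin p → ℝ) → ℝ := fun x => x ⬝ᵥ (Γ⁻¹ *ᵥ x)
  let N : (Fin p → ℝ) → ℝ := fun x => √(∑ i, (Γ⁻¹ *ᵥ x) i ^ 2)
  let g : (Fin p → ℝ) → ℝ := fun x => N x * Real.exp (-(1 / 2 : ℝ) * Q x)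
  let k : (Fin p → ℝ) → (Fin p → ℝ) → ℝ := fun t s => Real.exp (-(lam ^ 2 / 2) * Q (t - s))
  let f : (Fin p → ℝ) → (Fin p → ℝ) → ℝ := fun t s =>
    k t s * (w ⬝ᵥ (Γ⁻¹ *ᵥ s)) * (w ⬝ᵥ (Γ⁻¹ *ᵥ t)) *
      Real.exp (-(1 / 2 : ℝ) * Q s) * Real.exp (-(1 / 2 : ℝ) * Q t)
  let W := ∑ i, w i ^ 2
  have hg : Integrable g := hΓ.integrable_norm_mul_exp
  have hQ : ∀ x, 0 ≤ Q x := fun x => by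
    simpa [Q] using hΓ.inv.posSemidef.dotProduct_mulVec_nonneg x
  have hk : ∀ t s, ‖k t s‖ ≤ 1 := fun t s => by
    rw [Real.norm_of_nonneg (Real.exp_nonneg _), Real.exp_le_one_iff]
    exact mul_nonpos_of_nonpos_of_nonneg (neg_nonpos.mpr (by positivity)) (hQ _)
  have hg0 : ∀ x, 0 ≤ g x := fun x => by positivity
  have hW : 0 ≤ W := by positivity
  have hprod : Integrable (fun z : (Fin p → ℝ) × (Fin p → ℝ) =>
      k z.1 z.2 * (g z.1 * g z.2)) (volume.prod volume) :=
    (hg.mul_prod hg).bdd_mul (c := 1) (Continuous.aestronglyMeasurable (by fun_prop))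
      (Filter.Eventually.of_forall fun z => hk _ _)
  have hinner : ∀ t, Integrable fun s => k t s * (g t * g s) := fun t =>
    (hg.const_mul (g t)).bdd_mul (c := 1) (Continuous.aestronglyMeasurable (by fun_prop))
      (Filter.Eventually.of_forall fun s => hk _ _)
  have hD : DK = ∫ t, ∫ s, k t s * (g t * g s) := by
    rw [hDK]
    congr! 4 with t s
    simp only [k, g, N, Q]
    ring
  have hI' : I w t0 = ∫ t, ∫ s, f t s := by
    rw [hI, ← integral_sub_right_eq_self (fun t => ∫ s, f t s) t0]
    refine integral_congr_ae (Filter.Eventually.of_forall fun t => ?_)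
    beta_reduce
    rw [← integral_sub_right_eq_self (f (t - t0)) t0]
    simp only [f, k, Q, sub_sub_sub_cancel_right]
  have hbound : ∀ t s, f t s ≤ k t s * (g t * g s) * W := fun t s => by
    have hs := abs_dotProduct_le_sqrt_mul_sqrt w (Γ⁻¹ *ᵥ s)
    have ht := abs_dotProduct_le_sqrt_mul_sqrt w (Γ⁻¹ *ᵥ t)
    have hst : (w ⬝ᵥ (Γ⁻¹ *ᵥ s)) * (w ⬝ᵥ (Γ⁻¹ *ᵥ t)) ≤ W * (N s * N t) := by
      refine (le_abs_self _).trans ?_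
      rw [abs_mul]
      refine (mul_le_mul hs ht (abs_nonneg _) (by positivity)).trans_eq ?_
      rw [mul_mul_mul_comm, Real.mul_self_sqrt hW]
    calc f t s = (k t s * Real.exp (-(1 / 2 : ℝ) * Q s) * Real.exp (-(1 / 2 : ℝ) * Q t)) *
          ((w ⬝ᵥ (Γ⁻¹ *ᵥ s)) * (w ⬝ᵥ (Γ⁻¹ *ᵥ t))) := by simp only [f]; ring
      _ ≤ (k t s * Real.exp (-(1 / 2 : ℝ) * Q s) * Real.exp (-(1 / 2 : ℝ) * Q t)) *
          (W * (N s * N t)) := mul_le_mul_of_nonneg_left hst (by positivity)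
      _ = _ := by simp only [g]; ring
  have hnn : ∀ t s, 0 ≤ k t s * (g t * g s) * W := fun t s =>
    mul_nonneg (mul_nonneg (Real.exp_nonneg _) (mul_nonneg (hg0 t) (hg0 s))) hW
  rw [hI', hD, ← integral_mul_const]
  refine integral_mono_of_nonneg_right (hprod.integral_prod_left.mul_const W)
    (fun t => ?_) (fun t => ?_)
  · rw [Pi.zero_apply, ← integral_mul_const]
    exact integral_nonneg (hnn t)
  · rw [← integral_mul_const]
    exact integral_mono_of_nonneg_right ((hinner t).mul_const W) (hnn t) (hbound t)
end

section
/- Let p ≥ 1 and let Γ be a diagonal real p×p matrix with positive diagonal entries Γ_1, …, Γ_p. For a diagonal real matrix W with diagonal entries W_1, …, W_p define h_W(s) := ½ (Σ_{i=1}^p s_i² Γ_i⁻² W_i) · exp(−½ Σ_{i=1}^p s_i²/Γ_i) for s ∈ ℝ^p, and for λ > 0 define J(λ, W) := ∫_{ℝ^p} ∫_{ℝ^p} exp(−½λ‖s−t‖₂²) h_W(s) h_W(t) ds dt. Then there exists L > 0 such that for every λ ≥ L there exists a constant D > 0, depending only on λ and Γ, with J(λ, W) ≥ D for every diagonal W satisfying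 Σ_i W_i² = 1. -/
open MeasureTheory

lemma integrable_pow_mul_gaussian {B : ℝ} (hB : 0 < B) (n : ℕ) :
    Integrable fun x : ℝ => x ^ n * Real.exp (-(B / 2) * x ^ 2) := by
  have h := integrable_rpow_mul_exp_neg_mul_sq (half_pos hB) (s := (n : ℝ))
    (by have : (0 : ℝ) ≤ n := n.cast_nonneg; linarith)
  simpa only [Real.rpow_natCast] using h

lemma hasDerivAt_gaussian (B x : ℝ) :
    HasDerivAt (fun x : ℝ => Real.exp (-(B / 2) * x ^ 2))
      (-B * (x * Real.exp (-(B / 2) * x ^ 2))) x := by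
  have h := (((hasDerivAt_pow 2 x).const_mul (-(B / 2))).exp)
  convert h using 1
  push_cast
  ring

lemma integral_id_mul_gaussian {B : ℝ} (hB : 0 < B) :
    ∫ x : ℝ, x * Real.exp (-(B / 2) * x ^ 2) = 0 := by
  have h0 := integrable_pow_mul_gaussian hB 0
  have h1 := integrable_pow_mul_gaussian hB 1
  simp only [pow_zero, one_mul, pow_one] at h0 h1
  have h := integral_eq_zero_of_hasDerivAt_of_integrable (hasDerivAt_gaussian B)
    (h1.const_mul _) h0
  rw [integral_const_mul] at h
  exact (mul_eq_zero.mp h).resolve_left (by linarith)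

lemma integral_pow_add_two_mul_gaussian {B : ℝ} (hB : 0 < B) (n : ℕ) :
    ∫ x : ℝ, x ^ (n + 2) * Real.exp (-(B / 2) * x ^ 2) =
      (n + 1) / B * ∫ x : ℝ, x ^ n * Real.exp (-(B / 2) * x ^ 2) := by
  have hd (x : ℝ) : HasDerivAt (fun x : ℝ => x ^ (n + 1) * Real.exp (-(B / 2) * x ^ 2))
      ((n + 1) * (x ^ n * Real.exp (-(B / 2) * x ^ 2)) -
        B * (x ^ (n + 2) * Real.exp (-(B / 2) * x ^ 2))) x := by
    refine ((hasDerivAt_pow (n + 1) x).mul (hasDerivAt_gaussian B x)).congr_deriv ?_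
    push_cast
    ring
  have hn := (integrable_pow_mul_gaussian hB n).const_mul ((n : ℝ) + 1)
  have hn2 := (integrable_pow_mul_gaussian hB (n + 2)).const_mul B
  have h := integral_eq_zero_of_hasDerivAt_of_integrable hd (hn.sub hn2)
    (integrable_pow_mul_gaussian hB (n + 1))
  rw [integral_sub hn hn2, integral_const_mul, integral_const_mul] at h
  rw [div_mul_eq_mul_div, eq_div_iff hB.ne']
  linarith

/-- The total mass of the unnormalized centered Gaussian weight with precision `B`. -/
noncomputable def gaussianMass (B : ℝ) : ℝ := ∫ x : ℝ, Real.exp (-(B / 2) * x ^ 2)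

lemma gaussianMass_pos {B : ℝ} (hB : 0 < B) : 0 < gaussianMass B := by
  rw [gaussianMass, integral_gaussian]
  positivity

lemma integral_sq_mul_gaussian {B : ℝ} (hB : 0 < B) :
    ∫ x : ℝ, x ^ 2 * Real.exp (-(B / 2) * x ^ 2) = gaussianMass B / B := by
  have h := integral_pow_add_two_mul_gaussian hB 0
  simp only [zero_add, Nat.cast_zero, pow_zero, one_mul] at h
  rw [h, gaussianMass]
  ring

lemma integral_pow_four_mul_gaussian {B : ℝ} (hB : 0 < B) :
    ∫ x : ℝ, x ^ 4 * Real.exp (-(B / 2) * x ^ 2) = 3 * gaussianMass B / B ^ 2 := by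
  have h := integral_pow_add_two_mul_gaussian hB 2
  rw [integral_sq_mul_gaussian hB] at h
  rw [h]
  push_cast
  ring

/-- The unnormalized density of a centered exchangeable pair of Gaussian variables. -/
noncomputable def pairKernel (A l s t : ℝ) : ℝ :=
  Real.exp (-(A / 2) * s ^ 2 - A / 2 * t ^ 2 + l * s * t)

lemma pairKernel_eq {A : ℝ} (hA : 0 < A) (l s t : ℝ) :
    pairKernel A l s t = Real.exp (-((A - l ^ 2 / A) / 2) * s ^ 2) *
      Real.exp (-(A / 2) * (t - l * s / A) ^ 2) := by
  rw [pairKernel, ← Real.exp_add]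
  congr 1
  field_simp
  ring

lemma integrable_pairKernel {A : ℝ} (hA : 0 < A) (l s : ℝ) :
    Integrable (pairKernel A l s) := by
  have h := ((integrable_pow_mul_gaussian hA 0).comp_sub_right (l * s / A)).const_mul
    (Real.exp (-((A - l ^ 2 / A) / 2) * s ^ 2))
  simpa only [pow_zero, one_mul, ← pairKernel_eq hA] using h

lemma integral_pairKernel {A : ℝ} (hA : 0 < A) (l s : ℝ) :
    ∫ t, pairKernel A l s t =
      gaussianMass A * Real.exp (-((A - l ^ 2 / A) / 2) * s ^ 2) := by
  simp_rw [pairKernel_eq hA, integral_const_mul]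
  rw [integral_sub_right_eq_self (fun t => Real.exp (-(A / 2) * t ^ 2)), gaussianMass, mul_comm]

lemma sq_mul_pairKernel_eq {A : ℝ} (hA : 0 < A) (l s t : ℝ) :
    t ^ 2 * pairKernel A l s t = Real.exp (-((A - l ^ 2 / A) / 2) * s ^ 2) *
      ((fun u => u ^ 2 * Real.exp (-(A / 2) * u ^ 2) +
        2 * (l * s / A) * (u * Real.exp (-(A / 2) * u ^ 2)) +
        (l * s / A) ^ 2 * Real.exp (-(A / 2) * u ^ 2)) (t - l * s / A)) := by
  rw [pairKernel_eq hA]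
  ring

lemma integrable_sq_mul_pairKernel {A : ℝ} (hA : 0 < A) (l s : ℝ) :
    Integrable fun t => t ^ 2 * pairKernel A l s t := by
  have h0 := integrable_pow_mul_gaussian hA 0
  have h1 := integrable_pow_mul_gaussian hA 1
  have h2 := integrable_pow_mul_gaussian hA 2
  simp only [pow_zero, one_mul, pow_one] at h0 h1
  simp_rw [sq_mul_pairKernel_eq hA]
  exact (((h2.add (h1.const_mul _)).add (h0.const_mul _)).comp_sub_right _).const_mul _

lemma integral_sq_mul_pairKernel {A : ℝ} (hA : 0 < A) (l s : ℝ) :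
    ∫ t, t ^ 2 * pairKernel A l s t =
      gaussianMass A * (1 / A * Real.exp (-((A - l ^ 2 / A) / 2) * s ^ 2) +
        (l / A) ^ 2 * (s ^ 2 * Real.exp (-((A - l ^ 2 / A) / 2) * s ^ 2))) := by
  have h0 := integrable_pow_mul_gaussian hA 0
  have h1 := integrable_pow_mul_gaussian hA 1
  have h2 := integrable_pow_mul_gaussian hA 2
  simp only [pow_zero, one_mul, pow_one] at h0 h1
  have h21 : Integrable fun u : ℝ => u ^ 2 * Real.exp (-(A / 2) * u ^ 2) +
      2 * (l * s / A) * (u * Real.exp (-(A / 2) * u ^ 2)) := h2.add (h1.const_mul _)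
  simp_rw [sq_mul_pairKernel_eq hA, integral_const_mul]
  rw [integral_sub_right_eq_self (fun u => u ^ 2 * Real.exp (-(A / 2) * u ^ 2) +
      2 * (l * s / A) * (u * Real.exp (-(A / 2) * u ^ 2)) +
      (l * s / A) ^ 2 * Real.exp (-(A / 2) * u ^ 2)),
    integral_add h21 (h0.const_mul _), integral_add h2 (h1.const_mul _), integral_const_mul, integral_const_mul,
    integral_sq_mul_gaussian hA, integral_id_mul_gaussian hA, ← gaussianMass]
  ring

/-- `pairKernel` weighted by `s ^ 2` if `P` holds and by `t ^ 2` if `Q` holds. -/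
noncomputable def pairMoment (A l : ℝ) (P Q : Prop) [Decidable P] [Decidable Q] (s t : ℝ) : ℝ :=
  (if P then s ^ 2 else 1) * ((if Q then t ^ 2 else 1) * pairKernel A l s t)

lemma integrable_pairMoment {A : ℝ} (hA : 0 < A) (l : ℝ) (P Q : Prop) [Decidable P]
    [Decidable Q] (s : ℝ) : Integrable (pairMoment A l P Q s) := by
  unfold pairMoment
  refine Integrable.const_mul ?_ _
  by_cases hQ : Q
  · simpa only [hQ, if_true] using integrable_sq_mul_pairKernel hA l s
  · simpa only [hQ, if_false, one_mul] using integrable_pairKernel hA l s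

lemma integrable_integral_pairMoment {A l : ℝ} (hA : 0 < A) (hB : 0 < A - l ^ 2 / A)
    (P Q : Prop) [Decidable P] [Decidable Q] :
    Integrable fun s => ∫ t, pairMoment A l P Q s t := by
  have h0 := integrable_pow_mul_gaussian hB 0
  have h2 := integrable_pow_mul_gaussian hB 2
  have h4 := integrable_pow_mul_gaussian hB 4
  simp only [pow_zero, one_mul] at h0
  simp only [pairMoment, integral_const_mul]
  by_cases hQ : Q <;> by_cases hP : P <;>
    simp only [hP, hQ, if_true, if_false, one_mul, integral_sq_mul_pairKernel hA,
      integral_pairKernel hA]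
  · convert ((h2.const_mul (1 / A)).add (h4.const_mul ((l / A) ^ 2))).const_mul
      (gaussianMass A) using 2
    simp only [Pi.add_apply]
    ring
  · exact ((h0.const_mul (1 / A)).add (h2.const_mul ((l / A) ^ 2))).const_mul _
  · convert h2.const_mul (gaussianMass A) using 2
    ring
  · exact h0.const_mul _

lemma integral_integral_pairMoment {A l : ℝ} (hA : 0 < A) (hB : 0 < A - l ^ 2 / A)
    (P Q : Prop) [Decidable P] [Decidable Q] :
    ∫ s, ∫ t, pairMoment A l P Q s t =
      gaussianMass A * gaussianMass (A - l ^ 2 / A) *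
        ((if P then (A - l ^ 2 / A)⁻¹ else 1) * ((if Q then (A - l ^ 2 / A)⁻¹ else 1) *
          (if P ∧ Q then 1 + 2 * (l / A) ^ 2 else 1))) := by
  have h0 := integrable_pow_mul_gaussian hB 0
  have h2 := integrable_pow_mul_gaussian hB 2
  have h4 := integrable_pow_mul_gaussian hB 4
  have i0 : ∫ x : ℝ, Real.exp (-((A - l ^ 2 / A) / 2) * x ^ 2) =
    gaussianMass (A - l ^ 2 / A) := rfl
  have i2 := integral_sq_mul_gaussian hB
  have i4 := integral_pow_four_mul_gaussian hB
  have hBA : l ^ 2 = A * (A - (A - l ^ 2 / A)) := by field_simp; ring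
  simp only [pow_zero, one_mul] at h0
  simp only [pairMoment, integral_const_mul]
  by_cases hQ : Q <;> by_cases hP : P <;>
    simp only [hP, hQ, if_true, if_false, one_mul, mul_one, and_true, and_false,
      integral_sq_mul_pairKernel hA, integral_pairKernel hA]
  · have e (x : ℝ) : x ^ 2 * (gaussianMass A *
        (1 / A * Real.exp (-((A - l ^ 2 / A) / 2) * x ^ 2) +
          (l / A) ^ 2 * (x ^ 2 * Real.exp (-((A - l ^ 2 / A) / 2) * x ^ 2)))) =
        gaussianMass A * (1 / A * (x ^ 2 * Real.exp (-((A - l ^ 2 / A) / 2) * x ^ 2)) +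
          (l / A) ^ 2 * (x ^ 4 * Real.exp (-((A - l ^ 2 / A) / 2) * x ^ 2))) := by ring
    simp_rw [e]
    rw [integral_const_mul, integral_add (h2.const_mul _) (h4.const_mul _), integral_const_mul,
      integral_const_mul, i2, i4]
    generalize A - l ^ 2 / A = B at *
    rw [div_pow, hBA]
    field_simp
    ring
  · rw [integral_const_mul, integral_add (h0.const_mul _) (h2.const_mul _), integral_const_mul,
      integral_const_mul, i0, i2]
    generalize A - l ^ 2 / A = B at *
    rw [div_pow, hBA]
    field_simp
    ring
  · have e (x : ℝ) : x ^ 2 * (gaussianMass A * Real.exp (-((A - l ^ 2 / A) / 2) * x ^ 2)) =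
        gaussianMass A * (x ^ 2 * Real.exp (-((A - l ^ 2 / A) / 2) * x ^ 2)) := by ring
    simp_rw [e]
    rw [integral_const_mul, i2]
    ring
  · rw [integral_const_mul, i0]

section Multivariate

variable {ι : Type*} [Fintype ι]

lemma integral_integral_sum_sum {X Y : Type*} [MeasurableSpace X] [MeasurableSpace Y]
    {μ : Measure X} {ν : Measure Y} {f : ι → ι → X → Y → ℝ} (c : ι → ι → ℝ)
    (hf : ∀ i j s, Integrable (f i j s) ν)
    (hf' : ∀ i j, Integrable (fun s => ∫ t, f i j s t ∂ν) μ) :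
    ∫ s, ∫ t, ∑ i, ∑ j, c i j * f i j s t ∂ν ∂μ =
      ∑ i, ∑ j, c i j * ∫ s, ∫ t, f i j s t ∂ν ∂μ := by
  have h (s : X) : ∫ t, ∑ i, ∑ j, c i j * f i j s t ∂ν =
      ∑ i, ∑ j, c i j * ∫ t, f i j s t ∂ν := by
    rw [integral_finsetSum _ fun i _ => integrable_finsetSum _ fun j _ => (hf i j s).const_mul _]
    refine Finset.sum_congr rfl fun i _ => ?_
    rw [integral_finsetSum _ fun j _ => (hf i j s).const_mul _]
    simp_rw [integral_const_mul]
  simp_rw [h]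
  rw [integral_finsetSum _ fun i _ => integrable_finsetSum _ fun j _ => (hf' i j).const_mul _]
  refine Finset.sum_congr rfl fun i _ => ?_
  rw [integral_finsetSum _ fun j _ => (hf' i j).const_mul _]
  simp_rw [integral_const_mul]

variable [DecidableEq ι]

/-- The product of `s i ^ 2` and `t j ^ 2` integrated against a product of pair kernels. -/
lemma integral_integral_prod_pairMoment {A : ι → ℝ} {l : ℝ} (hA : ∀ k, 0 < A k)
    (hB : ∀ k, 0 < A k - l ^ 2 / A k) (i j : ι) :
    ∫ s : ι → ℝ, ∫ t : ι → ℝ, ∏ k, pairMoment (A k) l (k = i) (k = j) (s k) (t k) =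
      (∏ k, gaussianMass (A k) * gaussianMass (A k - l ^ 2 / A k)) *
        ((A i - l ^ 2 / A i)⁻¹ * ((A j - l ^ 2 / A j)⁻¹ *
          (if i = j then 1 + 2 * (l / A i) ^ 2 else 1))) := by
  have h (s : ι → ℝ) : ∫ t : ι → ℝ, ∏ k, pairMoment (A k) l (k = i) (k = j) (s k) (t k) =
      ∏ k, ∫ t, pairMoment (A k) l (k = i) (k = j) (s k) t :=
    integral_fintype_prod_volume_eq_prod fun k => pairMoment (A k) l (k = i) (k = j) (s k)
  simp_rw [h]
  rw [integral_fintype_prod_volume_eq_prod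
    fun k s => ∫ t, pairMoment (A k) l (k = i) (k = j) s t]
  simp_rw [integral_integral_pairMoment (hA _) (hB _), Finset.prod_mul_distrib]
  have h3 : ∏ k, (if k = i ∧ k = j then 1 + 2 * (l / A k) ^ 2 else 1) =
      if i = j then 1 + 2 * (l / A i) ^ 2 else 1 := by
    simp_rw [ite_and]
    simp
  simp [h3]

lemma integrable_prod_pairMoment {A : ι → ℝ} (hA : ∀ k, 0 < A k) (l : ℝ)
    (i j : ι) (s : ι → ℝ) :
    Integrable fun t : ι → ℝ => ∏ k, pairMoment (A k) l (k = i) (k = j) (s k) (t k) :=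
  Integrable.fintype_prod (μ := fun _ => volume)
    (f := fun k => pairMoment (A k) l (k = i) (k = j) (s k))
    fun k => integrable_pairMoment (hA k) l (k = i) (k = j) (s k)

lemma integrable_integral_prod_pairMoment {A : ι → ℝ} {l : ℝ} (hA : ∀ k, 0 < A k)
    (hB : ∀ k, 0 < A k - l ^ 2 / A k) (i j : ι) :
    Integrable fun s : ι → ℝ => ∫ t : ι → ℝ,
      ∏ k, pairMoment (A k) l (k = i) (k = j) (s k) (t k) := by
  have h (s : ι → ℝ) : ∫ t : ι → ℝ, ∏ k, pairMoment (A k) l (k = i) (k = j) (s k) (t k) =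
      ∏ k, ∫ t, pairMoment (A k) l (k = i) (k = j) (s k) t :=
    integral_fintype_prod_volume_eq_prod fun k => pairMoment (A k) l (k = i) (k = j) (s k)
  simp_rw [h]
  exact Integrable.fintype_prod (μ := fun _ => volume)
    (f := fun k s => ∫ t, pairMoment (A k) l (k = i) (k = j) s t)
    fun k => integrable_integral_pairMoment (hA k) (hB k) (k = i) (k = j)

lemma integral_integral_quadratic_pairKernel {A : ι → ℝ} {l : ℝ} (hA : ∀ k, 0 < A k)
    (hB : ∀ k, 0 < A k - l ^ 2 / A k) (c : ι → ℝ) :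
    ∫ s : ι → ℝ, ∫ t : ι → ℝ,
        (∑ i, c i * s i ^ 2) * (∑ j, c j * t j ^ 2) * ∏ k, pairKernel (A k) l (s k) (t k) =
      (∏ k, gaussianMass (A k) * gaussianMass (A k - l ^ 2 / A k)) *
        ((∑ i, c i * (A i - l ^ 2 / A i)⁻¹) ^ 2 +
          ∑ i, c i ^ 2 * (2 * (l / A i * (A i - l ^ 2 / A i)⁻¹) ^ 2)) := by
  have h (s t : ι → ℝ) :
      (∑ i, c i * s i ^ 2) * (∑ j, c j * t j ^ 2) * ∏ k, pairKernel (A k) l (s k) (t k) =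
        ∑ i, ∑ j, c i * c j * ∏ k, pairMoment (A k) l (k = i) (k = j) (s k) (t k) := by
    simp_rw [pairMoment, Finset.prod_mul_distrib, Finset.prod_ite_eq' Finset.univ]
    simp only [Finset.mem_univ, if_true]
    rw [Finset.sum_mul_sum, Finset.sum_mul]
    refine Finset.sum_congr rfl fun i _ => ?_
    rw [Finset.sum_mul]
    refine Finset.sum_congr rfl fun j _ => ?_
    ring
  simp_rw [h]
  let f (i j : ι) (s t : ι → ℝ) : ℝ := ∏ k, pairMoment (A k) l (k = i) (k = j) (s k) (t k)
  have hf (i j : ι) (s : ι → ℝ) : Integrable (f i j s) volume :=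
    integrable_prod_pairMoment hA l i j s
  have hf' (i j : ι) : Integrable (fun s => ∫ t, f i j s t) volume :=
    integrable_integral_prod_pairMoment hA hB i j
  rw [integral_integral_sum_sum (fun i j => c i * c j) hf hf']
  simp only [f]
  simp_rw [integral_integral_prod_pairMoment hA hB]
  rw [sq (∑ i, _), Finset.sum_mul_sum, ← Finset.sum_add_distrib, Finset.mul_sum]
  refine Finset.sum_congr rfl fun i _ => ?_
  have e (j : ι) : (if i = j then 1 + 2 * (l / A i) ^ 2 else 1) =
      1 + if i = j then 2 * (l / A i) ^ 2 else 0 := by split_ifs <;> simp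
  simp_rw [e, mul_add, Finset.sum_add_distrib, mul_ite, mul_zero, Finset.sum_ite_eq,
    Finset.mem_univ, if_true, Finset.mul_sum]
  congr 1
  · refine Finset.sum_congr rfl fun j _ => ?_
    ring
  · ring

end Multivariate

/-- Lemma 3.1 of the paper: the squared kernel norm of the derivative of a Gaussian
measure with respect to its (diagonal) covariance, in a unit diagonal direction `W`, is
bounded below by a positive constant depending only on `λ` and `Γ`, for all `λ` large
enough. -/
theorem stmt_13 {p : ℕ} (hp : 1 ≤ p) (Γ : Fin p → ℝ) (hΓ : ∀ i, 0 < Γ i)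
    (h : (Fin p → ℝ) → (Fin p → ℝ) → ℝ)
    (hh : ∀ W s, h W s = (1 / 2 : ℝ) * (∑ i, s i ^ 2 * ((Γ i)⁻¹) ^ 2 * W i) *
      Real.exp (-(1 / 2 : ℝ) * ∑ i, s i ^ 2 / Γ i))
    (J : ℝ → (Fin p → ℝ) → ℝ)
    (hJ : ∀ lam W, J lam W = ∫ s : Fin p → ℝ, ∫ t : Fin p → ℝ,
      Real.exp (-(lam / 2) * ∑ i, (s i - t i) ^ 2) * h W s * h W t) :
    ∃ L : ℝ, 0 < L ∧ ∀ lam : ℝ, L ≤ lam → ∃ D : ℝ, 0 < D ∧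
      ∀ W : Fin p → ℝ, (∑ i, W i ^ 2) = 1 → D ≤ J lam W := by
  have : Nonempty (Fin p) := ⟨⟨0, hp⟩⟩
  refine ⟨1, one_pos, fun lam hlam => ?_⟩
  have hl : 0 < lam := by linarith
  set A : Fin p → ℝ := fun k => lam + (Γ k)⁻¹ with hAdef
  have hlA (k) : lam < A k := lt_add_of_pos_right _ (inv_pos.mpr (hΓ k))
  have hA (k) : 0 < A k := hl.trans (hlA k)
  have hB (k) : 0 < A k - lam ^ 2 / A k := by
    rw [sub_pos, div_lt_iff₀ (hA k), ← sq]
    exact pow_lt_pow_left₀ (hlA k) hl.le two_ne_zero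
  have hJW (W : Fin p → ℝ) :
      J lam W = (∏ k, gaussianMass (A k) * gaussianMass (A k - lam ^ 2 / A k)) *
        ((∑ i, 1 / 2 * (Γ i)⁻¹ ^ 2 * W i * (A i - lam ^ 2 / A i)⁻¹) ^ 2 +
          ∑ i, (1 / 2 * (Γ i)⁻¹ ^ 2 * W i) ^ 2 *
            (2 * (lam / A i * (A i - lam ^ 2 / A i)⁻¹) ^ 2)) := by
    rw [← integral_integral_quadratic_pairKernel hA hB, hJ]
    refine integral_congr_ae (.of_forall fun s => integral_congr_ae (.of_forall fun t => ?_))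
    have hexp : Real.exp (-(lam / 2) * ∑ i, (s i - t i) ^ 2) *
        Real.exp (-(1 / 2 : ℝ) * ∑ i, s i ^ 2 / Γ i) *
        Real.exp (-(1 / 2 : ℝ) * ∑ i, t i ^ 2 / Γ i) =
        ∏ k, pairKernel (A k) lam (s k) (t k) := by
      simp_rw [pairKernel, ← Real.exp_sum, ← Real.exp_add, Finset.mul_sum,
        ← Finset.sum_add_distrib]
      congr 1
      refine Finset.sum_congr rfl fun i _ => ?_
      simp only [hAdef, div_eq_mul_inv]
      ring
    have hsum (x : Fin p → ℝ) : (1 / 2 : ℝ) * ∑ i, x i ^ 2 * (Γ i)⁻¹ ^ 2 * W i =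
        ∑ i, 1 / 2 * (Γ i)⁻¹ ^ 2 * W i * x i ^ 2 := by
      rw [Finset.mul_sum]
      refine Finset.sum_congr rfl fun i _ => ?_
      ring
    simp only [hh, hsum, ← hexp]
    ring
  have hZ : 0 < ∏ k, gaussianMass (A k) * gaussianMass (A k - lam ^ 2 / A k) :=
    Finset.prod_pos fun k _ => mul_pos (gaussianMass_pos (hA k)) (gaussianMass_pos (hB k))
  set q : Fin p → ℝ := fun i =>
    (1 / 2 * (Γ i)⁻¹ ^ 2) ^ 2 * (2 * (lam / A i * (A i - lam ^ 2 / A i)⁻¹) ^ 2) with hq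
  have hqpos (i) : 0 < q i := by
    have := hΓ i
    have := hA i
    have := hB i
    simp only [hq]
    positivity
  obtain ⟨i₀, hi₀⟩ := Finite.exists_min q
  refine ⟨_, mul_pos hZ (hqpos i₀), fun W hW => ?_⟩
  rw [hJW W]
  refine mul_le_mul_of_nonneg_left ?_ hZ.le
  calc q i₀ = ∑ i, W i ^ 2 * q i₀ := by rw [← Finset.sum_mul, hW, one_mul]
    _ ≤ ∑ i, W i ^ 2 * q i :=
      Finset.sum_le_sum fun i _ => mul_le_mul_of_nonneg_left (hi₀ i) (sq_nonneg _)
    _ = ∑ i, (1 / 2 * (Γ i)⁻¹ ^ 2 * W i) ^ 2 *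
          (2 * (lam / A i * (A i - lam ^ 2 / A i)⁻¹) ^ 2) :=
      Finset.sum_congr rfl fun i _ => by simp only [hq]; ring
    _ ≤ _ := le_add_of_nonneg_left (sq_nonneg _)
end

section
/- Let p, r ≥ 1 and let U, Z̄ be real p×r matrices satisfying Uᵀ Z̄ = Z̄ᵀ U. Then ‖U Z̄ᵀ + Z̄ Uᵀ‖_F² = 2‖Z̄ Uᵀ‖_F² + 2⟨Z̄ Z̄ᵀ, U Uᵀ⟩_F, and consequently ‖U Z̄ᵀ + Z̄ Uᵀ‖_F² ≥ 2 λ_min(Z̄ᵀ Z̄) · ‖U‖_F², where λ_min(Z̄ᵀZ̄) is the smallest eigenvalue of Z̄ᵀZ̄. -/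
open Matrix

/-- The sum of the squared entries of a real matrix, as a trace. -/
lemma sum_sq_eq_trace_mul_transpose {m n : Type*} [Fintype m] [Fintype n] (A : Matrix m n ℝ) :
    ∑ i, ∑ j, A i j ^ 2 = (A * Aᵀ).trace := by
  simp [Matrix.trace, Matrix.mul_apply, sq]

lemma posSemidef_sub_smul_one_of_le_eigenvalues {n : Type*} [Fintype n] [DecidableEq n]
    {M : Matrix n n ℝ} (hM : M.IsHermitian) {c : ℝ} (hc : ∀ i, c ≤ hM.eigenvalues i) :
    (M - c • (1 : Matrix n n ℝ)).PosSemidef := by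
  have hH : (M - c • (1 : Matrix n n ℝ)).IsHermitian :=
    hM.sub (by simp [Matrix.IsHermitian])
  refine hH.posSemidef_iff_eigenvalues_nonneg.2 fun i => ?_
  have h := hH.eigenvalues_mem_spectrum_real i
  generalize hH.eigenvalues i = x at h ⊢
  rw [← Algebra.algebraMap_eq_smul_one, ← spectrum.sub_singleton_eq,
    hM.spectrum_real_eq_range_eigenvalues] at h
  obtain ⟨_, ⟨j, rfl⟩, _, rfl, h⟩ := h
  simp only [Pi.zero_apply] at h ⊢
  linarith [hc j]

/-- The trace of `U M Uᵀ` is at least the smallest eigenvalue of `M` times `‖U‖_F²`. -/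
lemma iInf_eigenvalues_mul_trace_le {m n : Type*} [Fintype m] [Fintype n] [DecidableEq n]
    {M : Matrix n n ℝ} (hM : M.IsHermitian) (U : Matrix m n ℝ) :
    (⨅ i, hM.eigenvalues i) * (U * Uᵀ).trace ≤ (U * M * Uᵀ).trace := by
  have h := ((posSemidef_sub_smul_one_of_le_eigenvalues hM
    fun i => ciInf_le (Set.finite_range _).bddBelow i).mul_mul_conjTranspose_same U).trace_nonneg
  simpa [Matrix.mul_sub, Matrix.sub_mul] using h

/-- Key Hessian lower bound in the Procrustes direction (proof of Theorem 3.1 of the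
paper): if `Uᵀ Z̄ = Z̄ᵀ U` then
`‖U Z̄ᵀ + Z̄ Uᵀ‖_F² = 2 ‖Z̄ Uᵀ‖_F² + 2 ⟨Z̄ Z̄ᵀ, U Uᵀ⟩_F ≥ 2 λ_min(Z̄ᵀ Z̄) ‖U‖_F²`. -/
theorem stmt_16 {p r : ℕ} (U Zb : Matrix (Fin p) (Fin r) ℝ)
    (hcomm : Uᵀ * Zb = Zbᵀ * U) (hherm : (Zbᵀ * Zb).IsHermitian) :
    (∑ i, ∑ j, (U * Zbᵀ + Zb * Uᵀ) i j ^ 2)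
        = 2 * (∑ i, ∑ j, (Zb * Uᵀ) i j ^ 2) + 2 * ((Zb * Zbᵀ)ᵀ * (U * Uᵀ)).trace ∧
      2 * (⨅ i, hherm.eigenvalues i) * (∑ i, ∑ j, U i j ^ 2)
        ≤ ∑ i, ∑ j, (U * Zbᵀ + Zb * Uᵀ) i j ^ 2 := by
  have hcross : (Zb * Uᵀ * (Zb * Uᵀ)).trace = (Zb * Zbᵀ * (U * Uᵀ)).trace := by
    rw [Matrix.mul_assoc, ← Matrix.mul_assoc Uᵀ, hcomm]
    simp only [Matrix.mul_assoc]
  have hcross' : (U * Zbᵀ * (U * Zbᵀ)).trace = (Zb * Uᵀ * (Zb * Uᵀ)).trace := by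
    rw [← Matrix.trace_transpose]
    simp only [Matrix.transpose_mul, Matrix.transpose_transpose]
  have hsq : (U * Zbᵀ * (Zb * Uᵀ)).trace = (Zb * Uᵀ * (U * Zbᵀ)).trace :=
    Matrix.trace_mul_comm _ _
  have heq : (∑ i, ∑ j, (U * Zbᵀ + Zb * Uᵀ) i j ^ 2)
      = 2 * (∑ i, ∑ j, (Zb * Uᵀ) i j ^ 2) + 2 * ((Zb * Zbᵀ)ᵀ * (U * Uᵀ)).trace := by
    simp only [sum_sq_eq_trace_mul_transpose, Matrix.transpose_add, Matrix.transpose_mul,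
      Matrix.transpose_transpose, Matrix.add_mul, Matrix.mul_add, Matrix.trace_add]
    linarith
  refine ⟨heq, ?_⟩
  have hmin := iInf_eigenvalues_mul_trace_le hherm U
  have hnonneg : 0 ≤ ((Zb * Zbᵀ)ᵀ * (U * Uᵀ)).trace := by
    have h : ((Zb * Zbᵀ)ᵀ * (U * Uᵀ)).trace = ∑ i, ∑ j, (Zbᵀ * U) i j ^ 2 := by
      rw [sum_sq_eq_trace_mul_transpose, Matrix.transpose_mul, Matrix.transpose_mul,
        Matrix.transpose_transpose, Matrix.mul_assoc, Matrix.trace_mul_comm]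
      simp only [Matrix.mul_assoc]
    rw [h]
    positivity
  have hZU : ∑ i, ∑ j, (Zb * Uᵀ) i j ^ 2 = (U * (Zbᵀ * Zb) * Uᵀ).trace := by
    rw [sum_sq_eq_trace_mul_transpose, Matrix.trace_mul_comm]
    simp only [Matrix.transpose_mul, Matrix.transpose_transpose, Matrix.mul_assoc]
  rw [heq, hZU, sum_sq_eq_trace_mul_transpose U]
  linarith
end
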